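/- Let (X, F, S, μ) be a measure-preserving system with μ a probability measure, and let A ∈ F with μ(A) > 0. Then the induced system (A, F∩A, S_A, μ_A) is measure-preserving; moreover, the whole system (X, F, S, μ) is ergodic if and only if μ(⋃_{k≥1} S^{-k}(A)) = 1 and the induced system (A, F∩A, S_A, μ_A) is ergodic. -/

import Mathlib

open MeasureTheory Set Filter

/-- The first return time of `x` to `A` under `S`, with value `0` if `x` never returns. -/
noncomputable def firstReturnTime {X : Type*} (S : X → X) (A : Set X) (x : X) : ℕ :=
  sInf {k | 1 ≤ k ∧ S^[k] x ∈ A}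

/-- The induced map on `A`, extended to the whole space by the same formula. -/
noncomputable def inducedMap {X : Type*} (S : X → X) (A : Set X) (x : X) : X :=
  S^[firstReturnTime S A x] x

/-- The points first entering `A` after exactly `k + 1` steps, at a point of `B`. -/
def firstEntrySet {X : Type*} (S : X → X) (A B : Set X) (k : ℕ) : Set X :=
  {x | firstReturnTime S A x = k + 1 ∧ inducedMap S A x ∈ B}

section Pointwise

variable {X : Type*} {S : X → X} {A B : Set X} {x : X}

lemma firstReturnTime_ne_zero_iff :
    firstReturnTime S A x ≠ 0 ↔ ∃ k, 1 ≤ k ∧ S^[k] x ∈ A := by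
  constructor
  · intro h
    by_contra hne
    refine h (Nat.sInf_eq_zero.2 (Or.inr (eq_empty_of_forall_notMem fun k hk => hne ⟨k, hk⟩)))
  · intro h
    have := Nat.sInf_mem (s := {k | 1 ≤ k ∧ S^[k] x ∈ A}) h
    exact Nat.one_le_iff_ne_zero.1 this.1

lemma firstReturnTime_eq_succ_iff {k : ℕ} :
    firstReturnTime S A x = k + 1 ↔ S^[k + 1] x ∈ A ∧ ∀ j < k, S^[j + 1] x ∉ A := by
  constructor
  · intro h
    have hne : {k | 1 ≤ k ∧ S^[k] x ∈ A}.Nonempty :=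
      firstReturnTime_ne_zero_iff.1 (by rw [h]; exact k.succ_ne_zero)
    have hmem := Nat.sInf_mem hne
    change 1 ≤ firstReturnTime S A x ∧ S^[firstReturnTime S A x] x ∈ A at hmem
    rw [h] at hmem
    refine ⟨hmem.2, fun j hj hjA => ?_⟩
    have : firstReturnTime S A x ≤ j + 1 := Nat.sInf_le ⟨by omega, hjA⟩
    omega
  · rintro ⟨hk, hlt⟩
    refine le_antisymm (Nat.sInf_le ⟨by omega, hk⟩) (le_csInf ⟨k + 1, by omega, hk⟩ ?_)
    rintro j ⟨hj, hjA⟩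
    by_contra hjk
    refine hlt (j - 1) (by omega) ?_
    rwa [Nat.sub_add_cancel hj]

lemma firstReturnTime_of_apply_mem (h : S x ∈ A) : firstReturnTime S A x = 1 :=
  firstReturnTime_eq_succ_iff.2 ⟨h, by simp⟩

lemma firstReturnTime_eq_add_two_iff {k : ℕ} :
    firstReturnTime S A x = k + 2 ↔ S x ∉ A ∧ firstReturnTime S A (S x) = k + 1 := by
  rw [firstReturnTime_eq_succ_iff, firstReturnTime_eq_succ_iff, Nat.forall_lt_succ_left]
  simp only [Function.iterate_succ_apply, Function.iterate_zero, id]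
  tauto

lemma inducedMap_of_apply_mem (h : S x ∈ A) : inducedMap S A x = S x := by
  simp [inducedMap, firstReturnTime_of_apply_mem h]

lemma inducedMap_of_firstReturnTime_eq_add_two {k : ℕ} (h : firstReturnTime S A x = k + 2) :
    inducedMap S A x = inducedMap S A (S x) := by
  rw [inducedMap, inducedMap, (firstReturnTime_eq_add_two_iff.1 h).2, h,
    Function.iterate_succ_apply]

lemma firstEntrySet_zero : firstEntrySet S A B 0 = S ⁻¹' (A ∩ B) := by
  ext x
  constructor
  · rintro ⟨h, hB⟩
    have hA : S x ∈ A := (firstReturnTime_eq_succ_iff.1 h).1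
    exact ⟨hA, by rwa [inducedMap_of_apply_mem hA] at hB⟩
  · rintro ⟨hA, hB⟩
    exact ⟨firstReturnTime_of_apply_mem hA, by rwa [inducedMap_of_apply_mem hA]⟩

lemma firstEntrySet_succ (k : ℕ) :
    firstEntrySet S A B (k + 1) = S ⁻¹' (firstEntrySet S A B k \ A) := by
  ext x
  constructor
  · rintro ⟨h, hB⟩
    have h' := firstReturnTime_eq_add_two_iff.1 h
    rw [inducedMap_of_firstReturnTime_eq_add_two h] at hB
    exact ⟨⟨h'.2, hB⟩, h'.1⟩
  · rintro ⟨⟨h, hB⟩, hA⟩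
    have h' := firstReturnTime_eq_add_two_iff.2 ⟨hA, h⟩
    exact ⟨h', by rwa [inducedMap_of_firstReturnTime_eq_add_two h']⟩

lemma mem_iUnion_firstEntrySet :
    x ∈ ⋃ k, firstEntrySet S A B k ↔ firstReturnTime S A x ≠ 0 ∧ inducedMap S A x ∈ B := by
  simp only [firstEntrySet, mem_iUnion, mem_ofPred_eq, exists_and_right]
  refine and_congr_left' ⟨?_, Nat.exists_eq_succ_of_ne_zero⟩
  rintro ⟨k, hk⟩
  omega

end Pointwise

section Measurability

variable {X : Type*} [MeasurableSpace X] {S : X → X} {A B : Set X}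

lemma measurableSet_firstEntrySet (hS : Measurable S) (hA : MeasurableSet A)
    (hB : MeasurableSet B) (k : ℕ) : MeasurableSet (firstEntrySet S A B k) := by
  induction k with
  | zero => rw [firstEntrySet_zero]; exact hS (hA.inter hB)
  | succ k ih => rw [firstEntrySet_succ]; exact hS (ih.diff hA)

lemma measurable_firstReturnTime (hS : Measurable S) (hA : MeasurableSet A) :
    Measurable (firstReturnTime S A) := by
  have hsucc (k : ℕ) : MeasurableSet (firstReturnTime S A ⁻¹' {k + 1}) := by
    convert measurableSet_firstEntrySet hS hA MeasurableSet.univ k using 1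
    ext x
    simp [firstEntrySet]
  refine measurable_to_countable' fun k => ?_
  cases k with
  | succ k => exact hsucc k
  | zero =>
    convert (MeasurableSet.iUnion hsucc).compl using 1
    ext x
    cases h : firstReturnTime S A x <;> simp [h]

lemma measurable_inducedMap (hS : Measurable S) (hA : MeasurableSet A) :
    Measurable (inducedMap S A) :=
  (measurable_from_prod_countable_right (f := fun p : ℕ × X => S^[p.1] p.2)
    fun n => hS.iterate n).comp ((measurable_firstReturnTime hS hA).prodMk measurable_id)

end Measurability

namespace MeasureTheory.MeasurePreserving

variable {X : Type*} [MeasurableSpace X] {μ : Measure X} {S : X → X} {A B : Set X}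

lemma sum_inter_firstEntrySet (hS : MeasurePreserving S μ μ) (hA : MeasurableSet A)
    (hB : MeasurableSet B) (m : ℕ) :
    ∑ k ∈ Finset.range m, μ (firstEntrySet S A B k ∩ A) + μ (firstEntrySet S A B m) =
      μ (A ∩ B) := by
  induction m with
  | zero =>
    rw [Finset.sum_range_zero, zero_add, firstEntrySet_zero,
      hS.measure_preimage (hA.inter hB).nullMeasurableSet]
  | succ m ih =>
    have hm := measurableSet_firstEntrySet hS.measurable hA hB m
    rw [Finset.sum_range_succ, firstEntrySet_succ,
      hS.measure_preimage (hm.diff hA).nullMeasurableSet, add_assoc, measure_inter_add_sdiff _ hA,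
      ih]

lemma ae_firstReturnTime_ne_zero [IsFiniteMeasure μ] (hS : MeasurePreserving S μ μ)
    (hA : MeasurableSet A) : ∀ᵐ x ∂μ, x ∈ A → firstReturnTime S A x ≠ 0 := by
  filter_upwards [hS.conservative.ae_mem_imp_frequently_image_mem hA.nullMeasurableSet] with x hx hxA
  exact firstReturnTime_ne_zero_iff.2 (frequently_atTop.1 (hx hxA) 1)

lemma inducedMap_restrict [IsFiniteMeasure μ] (hS : MeasurePreserving S μ μ)
    (hA : MeasurableSet A) :
    MeasurePreserving (inducedMap S A) (μ.restrict A) (μ.restrict A) := by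
  have hT := measurable_inducedMap hS.measurable hA
  refine ⟨hT, Measure.eq_of_le_of_measure_univ_eq (Measure.le_iff.2 fun B hB => ?_) ?_⟩
  · rw [Measure.map_apply hT hB, Measure.restrict_apply (hT hB), Measure.restrict_apply hB]
    calc μ (inducedMap S A ⁻¹' B ∩ A) ≤ μ (⋃ k, firstEntrySet S A B k ∩ A) := by
          refine measure_mono_ae ?_
          filter_upwards [hS.ae_firstReturnTime_ne_zero hA] with x hx hxB
          change x ∈ ⋃ k, firstEntrySet S A B k ∩ A
          rw [← iUnion_inter]
          exact ⟨mem_iUnion_firstEntrySet.2 ⟨hx hxB.2, hxB.1⟩, hxB.2⟩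
      _ ≤ ∑' k, μ (firstEntrySet S A B k ∩ A) := measure_iUnion_le _
      _ ≤ μ (A ∩ B) := ENNReal.tsum_le_of_sum_range_le fun m =>
          le_self_add.trans (hS.sum_inter_firstEntrySet hA hB m).le
      _ = μ (B ∩ A) := by rw [inter_comm]
  · rw [Measure.map_apply hT MeasurableSet.univ, preimage_univ]

end MeasureTheory.MeasurePreserving

namespace Ergodic

variable {X : Type*} [MeasurableSpace X] {μ : Measure X} [IsFiniteMeasure μ] {S : X → X}
  {A : Set X}

lemma ae_eq_univ_iUnion_preimage_iterate (hS : Ergodic S μ) (hA : MeasurableSet A)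
    (hApos : μ A ≠ 0) : (⋃ k ∈ {k : ℕ | 1 ≤ k}, S^[k] ⁻¹' A) =ᵐ[μ] univ := by
  have hmeas : MeasurableSet (⋃ k ∈ {k : ℕ | 1 ≤ k}, S^[k] ⁻¹' A) :=
    .biUnion (to_countable _) fun k _ => hS.measurable.iterate k hA
  refine (hS.ae_empty_or_univ_of_preimage_ae_le hmeas.nullMeasurableSet
    (LE.le.eventuallyLE ?_)).resolve_left fun h => hApos ?_
  · intro x hx
    simp only [mem_preimage, mem_iUnion, mem_ofPred_eq] at hx ⊢
    obtain ⟨k, hk, hx⟩ := hx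
    exact ⟨k + 1, by omega, hx⟩
  · rw [← hS.measure_preimage hA.nullMeasurableSet]
    exact measure_mono_null (subset_biUnion_of_mem (u := fun k : ℕ => S^[k] ⁻¹' A)
      (mem_ofPred_eq.symm ▸ le_rfl : 1 ∈ {k : ℕ | 1 ≤ k})) (ae_eq_empty.1 h)

lemma preErgodic_inducedMap_restrict (hS : Ergodic S μ) (hA : MeasurableSet A) :
    PreErgodic (inducedMap S A) (μ.restrict A) := by
  refine ⟨fun B hB hTB => ?_⟩
  have hret := hS.toMeasurePreserving.ae_firstReturnTime_ne_zero hA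
  set C := ⋃ k, firstEntrySet S A B k with hC
  have hCmeas : MeasurableSet C :=
    .iUnion fun k => measurableSet_firstEntrySet hS.measurable hA hB k
  have hinv : S ⁻¹' C =ᵐ[μ] C := by
    refine eventuallyEq_set.2 ?_
    filter_upwards [hS.quasiMeasurePreserving.ae hret] with x hx
    rw [mem_preimage]
    by_cases hxA : S x ∈ A
    · rw [hC, mem_iUnion_firstEntrySet, mem_iUnion_firstEntrySet, ← mem_preimage, hTB,
        inducedMap_of_apply_mem hxA, firstReturnTime_of_apply_mem hxA]
      simp [hx hxA]
    · rw [hC, mem_iUnion, mem_iUnion, ← Nat.or_exists_add_one (p := fun k => x ∈ _)]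
      simp [firstEntrySet_zero, firstEntrySet_succ, hxA]
  have hCB : C =ᵐ[μ.restrict A] B := by
    refine eventuallyEq_set.2 ((ae_restrict_iff' hA).2 ?_)
    filter_upwards [hret] with x hx hxA
    rw [hC, mem_iUnion_firstEntrySet, ← mem_preimage, hTB]
    simp [hx hxA]
  exact ((hS.quasiErgodic.aeconst_set₀ hCmeas.nullMeasurableSet hinv).anti
    (ae_mono Measure.restrict_le_self)).congr hCB

end Ergodic

lemma measure_eq_zero_of_inter_eq_zero {X : Type*} [MeasurableSpace X] {μ : Measure X}
    {S : X → X} {A D : Set X} (hS : Measure.QuasiMeasurePreserving S μ μ)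
    (hcover : ∀ᵐ x ∂μ, x ∈ ⋃ k ∈ {k : ℕ | 1 ≤ k}, S^[k] ⁻¹' A)
    (hD : S ⁻¹' D = D) (hAD : μ (A ∩ D) = 0) : μ D = 0 := by
  have hnull : ∀ᵐ x ∂μ, ∀ k, S^[k] x ∉ A ∩ D :=
    ae_all_iff.2 fun k => (hS.iterate k).ae (measure_eq_zero_iff_ae_notMem.1 hAD)
  refine measure_eq_zero_iff_ae_notMem.2 ?_
  filter_upwards [hcover, hnull] with x hx hxk hxD
  simp only [mem_iUnion, mem_preimage] at hx
  obtain ⟨k, -, hk⟩ := hx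
  refine hxk k ⟨hk, ?_⟩
  rwa [← mem_preimage, Function.IsFixedPt.preimage_iterate hD k]

lemma PreErgodic.of_inducedMap_restrict {X : Type*} [MeasurableSpace X] {μ : Measure X}
    {S : X → X} {A : Set X} (hS : Measure.QuasiMeasurePreserving S μ μ)
    (hcover : ∀ᵐ x ∂μ, x ∈ ⋃ k ∈ {k : ℕ | 1 ≤ k}, S^[k] ⁻¹' A)
    (hT : PreErgodic (inducedMap S A) (μ.restrict A)) : PreErgodic S μ := by
  refine ⟨fun D hD hSD => ?_⟩
  have hTD : inducedMap S A ⁻¹' D = D := by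
    ext x
    change x ∈ S^[firstReturnTime S A x] ⁻¹' D ↔ x ∈ D
    rw [Function.IsFixedPt.preimage_iterate hSD]
  rw [eventuallyConst_set', ae_eq_empty, ae_eq_univ]
  refine (hT.measure_self_or_compl_eq_zero hD hTD).imp (fun h => ?_) fun h => ?_
  · rw [Measure.restrict_apply hD, inter_comm] at h
    exact measure_eq_zero_of_inter_eq_zero hS hcover hSD h
  · rw [Measure.restrict_apply hD.compl, inter_comm] at h
    exact measure_eq_zero_of_inter_eq_zero hS hcover (by rw [preimage_compl, hSD]) h


/-- induced systems: let `(X, F, S, μ)` be a measure-preserving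
probability system and `A` a measurable set with `μ(A) > 0`.  With the first return
time `n_A(x) = inf {k ≥ 1 | S^k x ∈ A}` (with `S_A x = x` when `x` never returns,
via the convention `sInf ∅ = 0`), the induced map `S_A x = S^[n_A x] x` and the
conditional measure `μ_A = μ(A)⁻¹ ⬝ μ|_A`, the induced system is measure-preserving;
moreover `(X, F, S, μ)` is ergodic if and only if `μ(⋃_{k ≥ 1} S^{-k} A) = 1` and
the induced system is ergodic. -/
theorem induced_system_measurePreserving_and_ergodic_iff
    {X : Type*} [MeasurableSpace X] (μ : Measure X) [IsProbabilityMeasure μ]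
    (S : X → X) (hS : MeasurePreserving S μ μ)
    (A : Set X) (hA : MeasurableSet A) (hApos : 0 < μ A) :
    MeasurePreserving (fun x => S^[sInf {k | 1 ≤ k ∧ S^[k] x ∈ A}] x)
        ((μ A)⁻¹ • μ.restrict A) ((μ A)⁻¹ • μ.restrict A) ∧
      (Ergodic S μ ↔
        μ (⋃ k ∈ {k : ℕ | 1 ≤ k}, S^[k] ⁻¹' A) = 1 ∧
          Ergodic (fun x => S^[sInf {k | 1 ≤ k ∧ S^[k] x ∈ A}] x)
            ((μ A)⁻¹ • μ.restrict A)) := by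
  have hc : (μ A)⁻¹ ≠ 0 := ENNReal.inv_ne_zero.2 (measure_ne_top μ A)
  have hT := (hS.inducedMap_restrict hA).smul_measure (μ A)⁻¹
  refine ⟨hT, fun h => ⟨?_, hT, ?_⟩, fun ⟨hU, h⟩ => ⟨hS, ?_⟩⟩
  · rw [measure_congr (h.ae_eq_univ_iUnion_preimage_iterate hA hApos.ne'), measure_univ]
  · exact (h.preErgodic_inducedMap_restrict hA).smul_measure _
  · have hmeas : MeasurableSet (⋃ k ∈ {k : ℕ | 1 ≤ k}, S^[k] ⁻¹' A) :=
      .biUnion (to_countable _) fun k _ => hS.measurable.iterate k hA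
    refine PreErgodic.of_inducedMap_restrict hS.quasiMeasurePreserving
      ((mem_ae_iff_prob_eq_one hmeas).2 hU) ⟨fun B hB hTB => ?_⟩
    simpa only [Measure.ae_ennreal_smul_measure_eq hc] using h.aeconst_set hB hTB
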